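/- arXiv:1812.05741 — 6 statements merged into one kernel-verified Lean document; each statement's English description precedes it below -/
import Mathlib

section
/- Let Θ be a real normed vector space, let Θ̃ ⊆ Θ be a nonempty closed convex subset, and let θ₀ ∈ Θ̃. Let T : Θ → Θ be a Borel measurable map such that for every θ ∈ Θ, Tθ ∈ Θ̃ and ‖θ − Tθ‖ = dist(θ, Θ̃) (i.e., Tθ is a best approximation of θ in Θ̃). Let d : Θ × Θ → [0,∞) be bi-Lipschitz with respect to ‖·‖ with constant c ≥ 1, and assume θ ↦ d(θ, θ₀) is Borel measurable. Let (μₙ) be a sequence of Borel probability measures on Θ and εₙ > 0 a sequence such that for every sequence Mₙ → ∞, μₙ{θ : d(θ, θ₀) > Mₙ εₙ} → 0 as n → ∞. Then the pushforward measures T₊μₙ satisfy the same contraction property at θ₀: for every sequence Mₙ → ∞, (T₊μₙ){θ̃ : d(θ̃, θ₀) > Mₙ εₙ} → 0 as n → ∞. -/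
open MeasureTheory Filter Topology

/-- A best approximation of `θ` in `S` is within twice the distance of `θ` from any point
of `S`. -/
theorem norm_bestApprox_sub_le {Θ : Type*} [SeminormedAddCommGroup Θ] {S : Set Θ}
    {θ p θ₀ : Θ} (hθ₀ : θ₀ ∈ S) (hp : ‖θ - p‖ = Metric.infDist θ S) :
    ‖p - θ₀‖ ≤ 2 * ‖θ - θ₀‖ := by
  have hle : ‖θ - p‖ ≤ ‖θ - θ₀‖ := by
    rw [hp, ← dist_eq_norm]
    exact Metric.infDist_le_dist_of_mem hθ₀
  have htri : ‖p - θ₀‖ ≤ ‖p - θ‖ + ‖θ - θ₀‖ := norm_sub_le_norm_sub_add_norm_sub p θ θ₀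
  rw [norm_sub_rev p θ] at htri
  linarith

/-- Contraction rate of the projected posterior for a closed convex subset of a normed
(Banach) space: if `θ₀` lies in the constrained set `Θ̃` and the unconstrained posteriors
`μₙ` contract at `θ₀` at rate `εₙ` with respect to a bi-Lipschitz semimetric `d`, then the
pushforwards under the metric projection `T` onto `Θ̃` contract at `θ₀` at rate at least
(a constant multiple of, hence the same rate) `εₙ`. -/
theorem projected_posterior_contraction_banach
    {Θ : Type*} [NormedAddCommGroup Θ] [NormedSpace ℝ Θ]
    [MeasurableSpace Θ] [BorelSpace Θ]
    (Θt : Set Θ) (hne : Θt.Nonempty) (hclosed : IsClosed Θt) (hconv : Convex ℝ Θt)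
    (θ₀ : Θ) (hθ₀ : θ₀ ∈ Θt)
    (T : Θ → Θ) (hTmeas : Measurable T)
    (hTmem : ∀ θ, T θ ∈ Θt)
    (hTbest : ∀ θ, ‖θ - T θ‖ = Metric.infDist θ Θt)
    (d : Θ → Θ → ℝ) (hd_nonneg : ∀ θ θ', 0 ≤ d θ θ')
    (c : ℝ) (hc : 1 ≤ c)
    (hd_lower : ∀ θ θ', c⁻¹ * ‖θ - θ'‖ ≤ d θ θ')
    (hd_upper : ∀ θ θ', d θ θ' ≤ c * ‖θ - θ'‖)
    (hd_meas : Measurable fun θ => d θ θ₀)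
    (μ : ℕ → Measure Θ) (hprob : ∀ n, IsProbabilityMeasure (μ n))
    (ε : ℕ → ℝ) (hε : ∀ n, 0 < ε n)
    (hcontract : ∀ M : ℕ → ℝ, Tendsto M atTop atTop →
      Tendsto (fun n => μ n {θ | d θ θ₀ > M n * ε n}) atTop (𝓝 0)) :
    ∀ M : ℕ → ℝ, Tendsto M atTop atTop →
      Tendsto (fun n => (μ n).map T {θ | d θ θ₀ > M n * ε n}) atTop (𝓝 0) := by
  intro M hM
  have hc0 : 0 < c := by linarith
  have hbound : ∀ θ, d (T θ) θ₀ ≤ d θ θ₀ * (2 * c ^ 2) := fun θ => by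
    have hlow : ‖θ - θ₀‖ ≤ c * d θ θ₀ := (inv_mul_le_iff₀ hc0).1 (hd_lower θ θ₀)
    calc d (T θ) θ₀ ≤ c * ‖T θ - θ₀‖ := hd_upper _ _
      _ ≤ c * (2 * (c * d θ θ₀)) := by
        gcongr
        exact (norm_bestApprox_sub_le hθ₀ (hTbest θ)).trans (by gcongr)
      _ = d θ θ₀ * (2 * c ^ 2) := by ring
  refine tendsto_of_tendsto_of_tendsto_of_le_of_le tendsto_const_nhds
    (hcontract (fun n => M n / (2 * c ^ 2)) (hM.atTop_div_const (by positivity)))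
    (fun _ => zero_le) fun n => ?_
  rw [Measure.map_apply hTmeas (measurableSet_lt measurable_const hd_meas)]
  refine measure_mono fun θ hθ => ?_
  change M n / (2 * c ^ 2) * ε n < d θ θ₀
  rw [div_mul_eq_mul_div, div_lt_iff₀ (by positivity)]
  exact lt_of_lt_of_le hθ (hbound θ)
end

section
/- Let Θ be a real Hilbert space (a complete real inner product space), let Θ̃ ⊆ Θ be a nonempty closed convex subset, and let T : Θ → Θ be the metric projection onto Θ̃, i.e., the Borel measurable map satisfying Tθ ∈ Θ̃ and ‖θ − Tθ‖ = dist(θ, Θ̃) for every θ ∈ Θ (which exists and is unique by the Hilbert projection theorem). Let d : Θ × Θ → [0,∞) be bi-Lipschitz with respect to ‖·‖ with constant c ≥ 1, with θ ↦ d(θ, x) Borel measurable for each x. Let θ₀ ∈ Θ be arbitrary (not necessarily in Θ̃). If (μₙ) is a sequence of Borel probability measures on Θ and εₙ > 0 is a sequence such that for every Mₙ → ∞, μₙ{θ : d(θ, θ₀) > Mₙ εₙ} → 0, then for every Mₙ → ∞, (T₊μₙ){θ̃ : d(θ̃, Tθ₀) > Mₙ εₙ} → 0, i.e., the projected posterior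 contracts at Tθ₀ at rate at least εₙ. -/
open MeasureTheory Filter Topology

open scoped RealInnerProductSpace in
/-- A best approximation in a convex set satisfies the variational inequality. -/
theorem real_inner_sub_sub_nonpos_of_norm_sub_eq_infDist
    {E : Type*} [NormedAddCommGroup E] [InnerProductSpace ℝ E] {K : Set E} (hK : Convex ℝ K)
    {u v w : E} (hv : v ∈ K) (huv : ‖u - v‖ = Metric.infDist u K) (hw : w ∈ K) :
    ⟪u - v, w - v⟫ ≤ 0 := by
  refine (norm_eq_iInf_iff_real_inner_le_zero hK hv).1 ?_ w hw
  simpa only [Metric.infDist_eq_iInf, dist_eq_norm] using huv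

open scoped RealInnerProductSpace in
/-- Best approximation in a convex set is non-expansive. -/
theorem norm_sub_le_of_norm_sub_eq_infDist
    {E : Type*} [NormedAddCommGroup E] [InnerProductSpace ℝ E] {K : Set E} (hK : Convex ℝ K)
    {x y p q : E} (hp : p ∈ K) (hq : q ∈ K)
    (hxp : ‖x - p‖ = Metric.infDist x K) (hyq : ‖y - q‖ = Metric.infDist y K) :
    ‖p - q‖ ≤ ‖x - y‖ := by
  have h₁ := real_inner_sub_sub_nonpos_of_norm_sub_eq_infDist hK hp hxp hq
  have h₂ := real_inner_sub_sub_nonpos_of_norm_sub_eq_infDist hK hq hyq hp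
  have h₃ : ⟪x - y, p - q⟫ = ⟪p - q, p - q⟫ - ⟪x - p, q - p⟫ - ⟪y - q, p - q⟫ := by
    simp only [inner_sub_left, inner_sub_right]
    ring
  rw [real_inner_self_eq_norm_mul_norm] at h₃
  have h₄ := real_inner_le_norm (x - y) (p - q)
  by_contra! h
  nlinarith [norm_nonneg (x - y)]

/-- Contraction rate of the projected posterior for a closed convex subset of a real Hilbert
space, at an arbitrary truth `θ₀ ∈ Θ` (not necessarily in the constrained set): if the
unconstrained posteriors `μₙ` contract at `θ₀` at rate `εₙ` with respect to a bi-Lipschitz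
semimetric `d`, then the pushforwards under the metric projection `T` onto the closed convex
set `Θ̃` contract at `T θ₀` at rate at least `εₙ`. -/
theorem projected_posterior_contraction_hilbert
    {Θ : Type*} [NormedAddCommGroup Θ] [InnerProductSpace ℝ Θ] [CompleteSpace Θ]
    [MeasurableSpace Θ] [BorelSpace Θ]
    (Θt : Set Θ) (hne : Θt.Nonempty) (hclosed : IsClosed Θt) (hconv : Convex ℝ Θt)
    (T : Θ → Θ) (hTmeas : Measurable T)
    (hTmem : ∀ θ, T θ ∈ Θt)
    (hTbest : ∀ θ, ‖θ - T θ‖ = Metric.infDist θ Θt)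
    (d : Θ → Θ → ℝ) (hd_nonneg : ∀ θ θ', 0 ≤ d θ θ')
    (c : ℝ) (hc : 1 ≤ c)
    (hd_lower : ∀ θ θ', c⁻¹ * ‖θ - θ'‖ ≤ d θ θ')
    (hd_upper : ∀ θ θ', d θ θ' ≤ c * ‖θ - θ'‖)
    (hd_meas : ∀ x : Θ, Measurable fun θ => d θ x)
    (θ₀ : Θ)
    (μ : ℕ → Measure Θ) (hprob : ∀ n, IsProbabilityMeasure (μ n))
    (ε : ℕ → ℝ) (hε : ∀ n, 0 < ε n)
    (hcontract : ∀ M : ℕ → ℝ, Tendsto M atTop atTop →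
      Tendsto (fun n => μ n {θ | d θ θ₀ > M n * ε n}) atTop (𝓝 0)) :
    ∀ M : ℕ → ℝ, Tendsto M atTop atTop →
      Tendsto (fun n => (μ n).map T {θ | d θ (T θ₀) > M n * ε n}) atTop (𝓝 0) := by
  intro M hM
  have hc₀ : 0 < c := zero_lt_one.trans_le hc
  refine tendsto_of_tendsto_of_tendsto_of_le_of_le tendsto_const_nhds
    (hcontract (fun n => M n / c ^ 2) (hM.atTop_div_const (by positivity)))
    (fun _ => zero_le) fun n => ?_
  rw [Measure.map_apply hTmeas (measurableSet_lt measurable_const (hd_meas (T θ₀)))]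
  refine measure_mono fun θ (hθ : M n * ε n < d (T θ) (T θ₀)) => ?_
  have hT : ‖T θ - T θ₀‖ ≤ ‖θ - θ₀‖ :=
    norm_sub_le_of_norm_sub_eq_infDist hconv (hTmem θ) (hTmem θ₀) (hTbest θ) (hTbest θ₀)
  have hnorm : ‖θ - θ₀‖ ≤ c * d θ θ₀ := (inv_mul_le_iff₀ hc₀).1 (hd_lower θ θ₀)
  have hd : d (T θ) (T θ₀) ≤ c ^ 2 * d θ θ₀ :=
    calc d (T θ) (T θ₀) ≤ c * ‖T θ - T θ₀‖ := hd_upper _ _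
      _ ≤ c * (c * d θ θ₀) := by gcongr; exact hT.trans hnorm
      _ = c ^ 2 * d θ θ₀ := by ring
  change M n / c ^ 2 * ε n < d θ θ₀
  rw [div_mul_eq_mul_div, div_lt_iff₀' (by positivity)]
  exact hθ.trans_le hd
end

section
/- Let 1 ≤ p ≤ m and let θ be a real m×p matrix with rank(θ) = p (full column rank). Then there exists a unique matrix Q in the Stiefel manifold St(p,m) = {Q ∈ ℝ^{m×p} : QᵀQ = I_p} attaining the minimal Frobenius distance to θ, i.e., a unique Q with QᵀQ = I_p and ‖θ − Q‖ = inf{‖θ − R‖ : RᵀR = I_p}. -/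
open Matrix

attribute [local instance] Matrix.frobeniusSeminormedAddCommGroup
  Matrix.frobeniusNormedAddCommGroup

namespace Matrix

variable {m n : Type*} [Fintype m] [Fintype n]

theorem frobenius_norm_sq_eq_trace (A : Matrix m n ℝ) : ‖A‖ ^ 2 = (Aᵀ * A).trace := by
  have h : 0 ≤ ∑ i, ∑ j, ‖A i j‖ ^ (2 : ℝ) := by positivity
  rw [frobenius_norm_def, ← Real.sqrt_eq_rpow, Real.sq_sqrt h, Finset.sum_comm]
  simp [trace, mul_apply, sq]

theorem trace_mul_mul_transpose_eq_sum (P : Matrix n n ℝ) (D : Matrix m n ℝ) :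
    (D * P * Dᵀ).trace = ∑ i, D i ⬝ᵥ (P *ᵥ D i) := by
  simp only [dotProduct_mulVec]
  rfl

theorem PosDef.trace_mul_mul_transpose_nonneg {P : Matrix n n ℝ} (hP : P.PosDef)
    (D : Matrix m n ℝ) : 0 ≤ (D * P * Dᵀ).trace := by
  rw [trace_mul_mul_transpose_eq_sum]
  exact Finset.sum_nonneg fun i _ => by
    simpa using hP.posSemidef.dotProduct_mulVec_nonneg (D i)

theorem PosDef.eq_zero_of_trace_mul_mul_transpose_eq_zero {P : Matrix n n ℝ} (hP : P.PosDef)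
    {D : Matrix m n ℝ} (h : (D * P * Dᵀ).trace = 0) : D = 0 := by
  rw [trace_mul_mul_transpose_eq_sum, Finset.sum_eq_zero_iff_of_nonneg fun i _ => by
    simpa using hP.posSemidef.dotProduct_mulVec_nonneg (D i)] at h
  refine funext fun i => ?_
  by_contra hi
  have hpos := hP.dotProduct_mulVec_pos hi
  rw [star_trivial, h i (Finset.mem_univ i)] at hpos
  exact lt_irrefl 0 hpos

variable [DecidableEq n]

theorem isUnit_of_rank_eq_card {A : Matrix n n ℝ} (h : A.rank = Fintype.card n) : IsUnit A := by
  rw [← mulVec_injective_iff_isUnit]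
  refine LinearMap.injective_iff_surjective (f := A.mulVecLin) |>.2 ?_
  rw [← LinearMap.range_eq_top]
  apply Submodule.eq_top_of_finrank_eq
  simpa [Matrix.rank] using h

open scoped MatrixOrder in
theorem PosDef.exists_posDef_mul_self_eq {A : Matrix n n ℝ} (hA : A.PosDef) :
    ∃ P : Matrix n n ℝ, P.PosDef ∧ P * P = A := by
  have hsq : CFC.sqrt A * CFC.sqrt A = A := CFC.sqrt_mul_sqrt_self A hA.posSemidef.nonneg
  refine ⟨CFC.sqrt A, ?_, hsq⟩
  rw [(nonneg_iff_posSemidef.1 (CFC.sqrt_nonneg A)).posDef_iff_isUnit]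
  have hu := hA.isUnit
  rw [isUnit_iff_isUnit_det] at hu ⊢
  rw [← hsq, det_mul] at hu
  exact isUnit_of_mul_isUnit_left hu

/-- Polar decomposition of a real matrix of full column rank. -/
theorem exists_polar_decomposition {A : Matrix m n ℝ} (hA : A.rank = Fintype.card n) :
    ∃ (U : Matrix m n ℝ) (P : Matrix n n ℝ), Uᵀ * U = 1 ∧ P.PosDef ∧ A = U * P := by
  have hpsd : (Aᵀ * A).PosSemidef := by
    simpa using posSemidef_conjTranspose_mul_self A
  obtain ⟨P, hP, hPP⟩ := (hpsd.posDef_iff_isUnit.2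
    (isUnit_of_rank_eq_card (by rw [rank_transpose_mul_self, hA]))).exists_posDef_mul_self_eq
  have hdet : IsUnit P.det := (isUnit_iff_isUnit_det P).1 hP.isUnit
  have hPt : Pᵀ = P := by simpa using hP.isHermitian.eq
  refine ⟨A * P⁻¹, P, ?_, hP, by rw [Matrix.mul_assoc, nonsing_inv_mul P hdet, Matrix.mul_one]⟩
  calc (A * P⁻¹)ᵀ * (A * P⁻¹) = P⁻¹ * (Aᵀ * A) * P⁻¹ := by
        rw [transpose_mul, transpose_nonsing_inv, hPt]
        simp only [Matrix.mul_assoc]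
    _ = (P⁻¹ * P) * (P * P⁻¹) := by rw [← hPP]; simp only [Matrix.mul_assoc]
    _ = 1 := by rw [nonsing_inv_mul P hdet, mul_nonsing_inv P hdet, Matrix.mul_one]

theorem frobenius_norm_sub_sq_eq_add_trace {U R : Matrix m n ℝ} {P : Matrix n n ℝ}
    (hU : Uᵀ * U = 1) (hR : Rᵀ * R = 1) (hP : Pᵀ = P) :
    ‖U * P - R‖ ^ 2 = ‖U * P - U‖ ^ 2 + ((R - U) * P * (R - U)ᵀ).trace := by
  have hcross : (P * (Rᵀ * U)).trace = (P * (Uᵀ * R)).trace := by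
    rw [← trace_transpose, transpose_mul, transpose_mul, transpose_transpose, hP, trace_mul_comm]
  have hUU (X : Matrix n n ℝ) : Uᵀ * (U * X) = X := by
    rw [← Matrix.mul_assoc, hU, Matrix.one_mul]
  have hRU : (Rᵀ * (U * P)).trace = (P * (Rᵀ * U)).trace := by
    rw [← Matrix.mul_assoc, trace_mul_comm]
  rw [trace_mul_comm, ← Matrix.mul_assoc, trace_mul_comm]
  simp only [frobenius_norm_sq_eq_trace, transpose_sub, transpose_mul, hP, Matrix.sub_mul,
    Matrix.mul_sub, Matrix.mul_assoc, trace_sub, hU, hR, hUU, hRU, hcross, Matrix.mul_one]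
  ring

end Matrix

/-- For a full column rank real `m × p` matrix `θ` (with `1 ≤ p ≤ m`), there is a unique
matrix `Q` in the Stiefel manifold `St(p, m) = {Q : Qᵀ Q = I}` attaining the minimal
Frobenius distance from `θ` to the Stiefel manifold. -/
theorem stiefel_projection_exists_unique
    (m p : ℕ) (hp : 1 ≤ p) (hpm : p ≤ m)
    (θ : Matrix (Fin m) (Fin p) ℝ) (hθ : θ.rank = p) :
    ∃! Q : Matrix (Fin m) (Fin p) ℝ,
      Qᵀ * Q = 1 ∧
      ‖θ - Q‖ = Metric.infDist θ {R : Matrix (Fin m) (Fin p) ℝ | Rᵀ * R = 1} := by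
  obtain ⟨U, P, hU, hP, rfl⟩ := exists_polar_decomposition (A := θ) (by simpa using hθ)
  have hPt : Pᵀ = P := by simpa using hP.isHermitian.eq
  have hmem : U ∈ {R : Matrix (Fin m) (Fin p) ℝ | Rᵀ * R = 1} := hU
  have hmin : Metric.infDist (U * P) {R : Matrix (Fin m) (Fin p) ℝ | Rᵀ * R = 1} =
      ‖U * P - U‖ := by
    refine le_antisymm ((Metric.infDist_le_dist_of_mem hmem).trans_eq (dist_eq_norm _ _))
      ((Metric.le_infDist ⟨U, hmem⟩).2 fun R hR => ?_)
    rw [dist_eq_norm]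
    refine le_of_sq_le_sq ?_ (norm_nonneg _)
    rw [frobenius_norm_sub_sq_eq_add_trace hU hR hPt]
    exact le_add_of_nonneg_right (hP.trace_mul_mul_transpose_nonneg _)
  rw [hmin]
  refine ⟨U, ⟨hU, rfl⟩, fun R ⟨hR, hdist⟩ => ?_⟩
  have hsq := frobenius_norm_sub_sq_eq_add_trace hU hR hPt
  rw [hdist, left_eq_add] at hsq
  exact sub_eq_zero.1 (hP.eq_zero_of_trace_mul_mul_transpose_eq_zero hsq)
end

section
/- Let 1 ≤ p ≤ m and let T : ℝ^{m×p} → ℝ^{m×p} be a Borel measurable map such that for every θ, Tθ ∈ St(p,m) and ‖θ − Tθ‖ = inf{‖θ − R‖ : R ∈ St(p,m)} in the Frobenius norm. Let θ₀ ∈ St(p,m), and let d : ℝ^{m×p} × ℝ^{m×p} → [0,∞) be bi-Lipschitz with respect to the Frobenius norm with constant c ≥ 1, with θ ↦ d(θ, θ₀) Borel measurable. If (μₙ) is a sequence of Borel probability measures on ℝ^{m×p} and εₙ > 0 is a sequence such that for every Mₙ → ∞, μₙ{θ : d(θ, θ₀) > Mₙ εₙ} → 0, then for every Mₙ → ∞,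 (T₊μₙ){θ̃ : d(θ̃, θ₀) > Mₙ εₙ} → 0; i.e., the contraction rate of the posterior projected onto the Stiefel manifold is at least that of the original posterior. -/
open Matrix MeasureTheory Filter Topology

attribute [local instance] Matrix.frobeniusSeminormedAddCommGroup
  Matrix.frobeniusNormedAddCommGroup

/-- Borel σ-algebra (equivalently, the product σ-algebra) on real `m × p` matrices. -/
noncomputable instance matrixMeasureSpace (m p : ℕ) :
    MeasureSpace (Matrix (Fin m) (Fin p) ℝ) :=
  inferInstanceAs (MeasureSpace (Fin m → Fin p → ℝ))

/-- A point of best approximation of `x` in `s` is at most twice as far from any `a ∈ s`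
as `x` is. -/
theorem dist_le_two_mul_of_dist_eq_infDist {E : Type*} [PseudoMetricSpace E] {s : Set E}
    {x y a : E} (hy : dist x y = Metric.infDist x s) (ha : a ∈ s) :
    dist y a ≤ 2 * dist x a := by
  have h : dist x y ≤ dist x a := hy ▸ Metric.infDist_le_dist_of_mem ha
  linarith [dist_triangle_left y a x]

/-- Contraction of the posterior projected onto the Stiefel manifold: if the true matrix
`θ₀` lies on the Stiefel manifold `{Q : Qᵀ Q = I}` and the unconstrained posteriors `μₙ`
contract at `θ₀` at rate `εₙ` with respect to a bi-Lipschitz (w.r.t. the Frobenius norm)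
semimetric `d`, then the pushforwards under the Frobenius metric projection `T` onto the
Stiefel manifold contract at `θ₀` at rate at least `εₙ`. -/
theorem projected_posterior_contraction_stiefel
    (m p : ℕ) (hp : 1 ≤ p) (hpm : p ≤ m)
    (T : Matrix (Fin m) (Fin p) ℝ → Matrix (Fin m) (Fin p) ℝ)
    (hTmeas : Measurable T)
    (hTmem : ∀ θ, (T θ)ᵀ * (T θ) = 1)
    (hTbest : ∀ θ, ‖θ - T θ‖ =
      Metric.infDist θ {R : Matrix (Fin m) (Fin p) ℝ | Rᵀ * R = 1})
    (θ₀ : Matrix (Fin m) (Fin p) ℝ) (hθ₀ : θ₀ᵀ * θ₀ = 1)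
    (d : Matrix (Fin m) (Fin p) ℝ → Matrix (Fin m) (Fin p) ℝ → ℝ)
    (hd_nonneg : ∀ θ θ', 0 ≤ d θ θ')
    (c : ℝ) (hc : 1 ≤ c)
    (hd_lower : ∀ θ θ', c⁻¹ * ‖θ - θ'‖ ≤ d θ θ')
    (hd_upper : ∀ θ θ', d θ θ' ≤ c * ‖θ - θ'‖)
    (hd_meas : Measurable fun θ => d θ θ₀)
    (μ : ℕ → Measure (Matrix (Fin m) (Fin p) ℝ))
    (hprob : ∀ n, IsProbabilityMeasure (μ n))
    (ε : ℕ → ℝ) (hε : ∀ n, 0 < ε n)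
    (hcontract : ∀ M : ℕ → ℝ, Tendsto M atTop atTop →
      Tendsto (fun n => μ n {θ | d θ θ₀ > M n * ε n}) atTop (𝓝 0)) :
    ∀ M : ℕ → ℝ, Tendsto M atTop atTop →
      Tendsto (fun n => (μ n).map T {θ | d θ θ₀ > M n * ε n}) atTop (𝓝 0) := by
  intro M hM
  have hc0 : 0 < c := by linarith
  have hK : 0 < 2 * c ^ 2 := by positivity
  have hd : ∀ θ, d (T θ) θ₀ ≤ 2 * c ^ 2 * d θ θ₀ := fun θ => by
    have hT : ‖T θ - θ₀‖ ≤ 2 * ‖θ - θ₀‖ := by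
      simpa only [dist_eq_norm] using
        dist_le_two_mul_of_dist_eq_infDist ((dist_eq_norm θ (T θ)).trans (hTbest θ)) hθ₀
    have hl : ‖θ - θ₀‖ ≤ c * d θ θ₀ := (inv_mul_le_iff₀ hc0).1 (hd_lower θ θ₀)
    calc d (T θ) θ₀ ≤ c * ‖T θ - θ₀‖ := hd_upper _ _
      _ ≤ c * (2 * (c * d θ θ₀)) := by gcongr; linarith
      _ = 2 * c ^ 2 * d θ θ₀ := by ring
  refine tendsto_of_tendsto_of_tendsto_of_le_of_le tendsto_const_nhds
    (hcontract (fun n => M n / (2 * c ^ 2)) (hM.atTop_div_const hK))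
    (fun _ => zero_le) fun n => ?_
  have hmeas : MeasurableSet {θ | d θ θ₀ > M n * ε n} :=
    measurableSet_lt measurable_const hd_meas
  simp only [Measure.map_apply hTmeas hmeas]
  refine measure_mono fun θ (hθ : M n * ε n < d (T θ) θ₀) => ?_
  change M n / (2 * c ^ 2) * ε n < d θ θ₀
  rw [div_mul_eq_mul_div, div_lt_iff₀' hK]
  exact hθ.trans_le (hd θ)
end

section
/- Consider the real 2×2 matrices θ₁ = [[1,0],[0,1]], θ₂ = [[0,1],[1,0]], and θ₃ = [[0.25,0.75],[0.75,0.25]], with the Frobenius norm. Then θ₁ and θ₂ lie in the Stiefel manifold St(2,2) = {Q : QᵀQ = I₂} while θ₃ does not; θ₂ is a best approximation of θ₃ in St(2,2); and ‖θ₂ − θ₁‖ = 2 > 1.5 = ‖θ₃ − θ₁‖. In particular, the metric projection onto St(2,2) is not non-expansive. -/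
open Matrix

attribute [local instance] Matrix.frobeniusSeminormedAddCommGroup
  Matrix.frobeniusNormedAddCommGroup

theorem frobenius_norm_fin_two (A : Matrix (Fin 2) (Fin 2) ℝ) :
    ‖A‖ = √(A 0 0 ^ 2 + A 0 1 ^ 2 + A 1 0 ^ 2 + A 1 1 ^ 2) := by
  rw [Matrix.frobenius_norm_def, ← Real.sqrt_eq_rpow]
  simp [Fin.sum_univ_two, add_assoc]

/-- A concrete example showing that the Frobenius metric projection onto `St(2,2)` is not
non-expansive: `θ₁, θ₂ ∈ St(2,2)`, `θ₃ ∉ St(2,2)`, `θ₂` is a best approximation of `θ₃`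
in `St(2,2)`, yet `‖θ₂ − θ₁‖ = 2 > 1.5 = ‖θ₃ − θ₁‖`. -/
theorem stiefel_projection_not_nonexpansive :
    let θ₁ : Matrix (Fin 2) (Fin 2) ℝ := !![1, 0; 0, 1]
    let θ₂ : Matrix (Fin 2) (Fin 2) ℝ := !![0, 1; 1, 0]
    let θ₃ : Matrix (Fin 2) (Fin 2) ℝ := !![0.25, 0.75; 0.75, 0.25]
    θ₁ᵀ * θ₁ = 1 ∧
    θ₂ᵀ * θ₂ = 1 ∧
    ¬(θ₃ᵀ * θ₃ = 1) ∧
    (∀ R : Matrix (Fin 2) (Fin 2) ℝ, Rᵀ * R = 1 → ‖θ₃ - θ₂‖ ≤ ‖θ₃ - R‖) ∧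
    ‖θ₂ - θ₁‖ = 2 ∧
    ‖θ₃ - θ₁‖ = 1.5 ∧
    ‖θ₃ - θ₁‖ < ‖θ₂ - θ₁‖ := by
  intro θ₁ θ₂ θ₃
  have h₂₁ : ‖θ₂ - θ₁‖ = 2 := by
    rw [frobenius_norm_fin_two, Real.sqrt_eq_iff_mul_self_eq_of_pos (by norm_num)]
    norm_num [θ₁, θ₂]
  have h₃₁ : ‖θ₃ - θ₁‖ = 1.5 := by
    rw [frobenius_norm_fin_two, Real.sqrt_eq_iff_mul_self_eq_of_pos (by norm_num)]
    norm_num [θ₁, θ₃]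
  refine ⟨?_, ?_, ?_, ?_, h₂₁, h₃₁, ?_⟩
  · ext i j
    fin_cases i <;> fin_cases j <;> simp [θ₁, Matrix.mul_apply]
  · ext i j
    fin_cases i <;> fin_cases j <;> simp [θ₂, Matrix.mul_apply]
  · intro h
    have h₀₁ := congrFun (congrFun h 0) 1
    norm_num [θ₃, Matrix.mul_apply, Fin.sum_univ_two] at h₀₁
  · intro R hR
    have h₀₀ := congrFun (congrFun hR 0) 0
    have h₀₁ := congrFun (congrFun hR 0) 1
    have h₁₁ := congrFun (congrFun hR 1) 1
    simp only [Matrix.mul_apply, Matrix.transpose_apply, Fin.sum_univ_two, Matrix.one_apply_eq,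
      Matrix.one_apply_ne zero_ne_one] at h₀₀ h₀₁ h₁₁
    rw [frobenius_norm_fin_two, frobenius_norm_fin_two]
    apply Real.sqrt_le_sqrt
    norm_num [θ₂, θ₃]
    have hsum : R 0 0 + R 0 1 + R 1 0 + R 1 1 ≤ 2 := by
      nlinarith [sq_nonneg (R 0 0 + R 0 1 - 1), sq_nonneg (R 1 0 + R 1 1 - 1)]
    have hb : R 0 1 ≤ 1 := by nlinarith [sq_nonneg (R 0 1 - 1), sq_nonneg (R 1 1)]
    have hc : R 1 0 ≤ 1 := by nlinarith [sq_nonneg (R 1 0 - 1), sq_nonneg (R 0 0)]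
    nlinarith
  · rw [h₂₁, h₃₁]
    norm_num
end

section
/- For every θ ∈ ℝ and σ > 0, the following two-sided inequality holds: θ ≤ θ·Φ(θ/σ) + σ·φ(θ/σ) ≤ θ + σ·φ(θ/σ)/Φ(θ/σ), where φ and Φ are the standard normal density and cumulative distribution function. That is, the mean of the Gaussian measure N(θ, σ²) pushed forward under x ↦ max(x,0) (the projected posterior mean) lies between θ and the mean θ + σφ(α)/{1 − Φ(α)} of the normal distribution truncated to [0,∞) (where α = −θ/σ); in particular the projected posterior mean is closer to θ than the truncated posterior mean is. -/
open MeasureTheory ProbabilityTheory Set Filter Topology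

lemma gaussianPDFReal_zero_one_apply (s : ℝ) :
    gaussianPDFReal 0 1 s = (Real.sqrt (2 * Real.pi))⁻¹ * Real.exp (-s ^ 2 / 2) := by
  simp [gaussianPDFReal]

lemma gaussianPDFReal_zero_neg (v : NNReal) (s : ℝ) :
    gaussianPDFReal 0 v (-s) = gaussianPDFReal 0 v s := by
  simp [gaussianPDFReal]

lemma hasDerivAt_neg_gaussianPDFReal_zero_one (s : ℝ) :
    HasDerivAt (fun x => -gaussianPDFReal 0 1 x) (s * gaussianPDFReal 0 1 s) s := by
  have h : HasDerivAt (fun x : ℝ => -x ^ 2 / 2) (-s) s := by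
    refine ((hasDerivAt_id' s).fun_pow 2).fun_neg.div_const 2 |>.congr_deriv ?_
    simp
    ring
  simp only [gaussianPDFReal_zero_one_apply]
  exact (h.exp.const_mul (Real.sqrt (2 * Real.pi))⁻¹).fun_neg.congr_deriv (by ring)

lemma integrable_mul_gaussianPDFReal_zero_one :
    Integrable (fun s => s * gaussianPDFReal 0 1 s) := by
  convert (integrable_mul_exp_neg_mul_sq (b := 1 / 2) (by norm_num)).const_mul
    (Real.sqrt (2 * Real.pi))⁻¹ using 2 with s
  rw [gaussianPDFReal_zero_one_apply, show -s ^ 2 / 2 = -(1 / 2) * s ^ 2 by ring]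
  ring

lemma tendsto_gaussianPDFReal_zero_one_atTop :
    Tendsto (gaussianPDFReal 0 1) atTop (𝓝 0) := by
  have h : Tendsto (fun s : ℝ => -s ^ 2 / 2) atTop atBot := by
    have := (tendsto_pow_atTop (α := ℝ) two_ne_zero).const_mul_atTop_of_neg
      (show (-1 / 2 : ℝ) < 0 by norm_num)
    exact this.congr fun s => by ring
  have := (Real.tendsto_exp_atBot.comp h).const_mul (Real.sqrt (2 * Real.pi))⁻¹
  rw [mul_zero] at this
  exact this.congr fun s => (gaussianPDFReal_zero_one_apply s).symm

/-- The first moment of the standard normal distribution over the upper tail. -/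
lemma integral_Ioi_mul_gaussianPDFReal_zero_one (t : ℝ) :
    ∫ s in Ioi t, s * gaussianPDFReal 0 1 s = gaussianPDFReal 0 1 t := by
  have h := tendsto_gaussianPDFReal_zero_one_atTop.neg
  rw [integral_Ioi_of_hasDerivAt_of_tendsto'
    (fun s _ => hasDerivAt_neg_gaussianPDFReal_zero_one s)
    integrable_mul_gaussianPDFReal_zero_one.integrableOn h]
  ring

/-- Upper bound on the Mills ratio of the standard normal distribution. -/
lemma mul_integral_Ioi_gaussianPDFReal_le (t : ℝ) :
    t * ∫ s in Ioi t, gaussianPDFReal 0 1 s ≤ gaussianPDFReal 0 1 t := by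
  rw [← integral_Ioi_mul_gaussianPDFReal_zero_one t, ← integral_const_mul]
  refine setIntegral_mono_on ((integrable_gaussianPDFReal 0 1).const_mul t).integrableOn
    integrable_mul_gaussianPDFReal_zero_one.integrableOn measurableSet_Ioi fun s hs => ?_
  exact mul_le_mul_of_nonneg_right (le_of_lt hs) (gaussianPDFReal_nonneg 0 1 s)

lemma integral_Iic_gaussianPDFReal_zero (v : NNReal) (t : ℝ) :
    ∫ s in Iic t, gaussianPDFReal 0 v s = ∫ s in Ioi (-t), gaussianPDFReal 0 v s := by
  rw [← integral_comp_neg_Iic]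
  simp only [gaussianPDFReal_zero_neg]

lemma integral_Iic_gaussianPDFReal_pos (μ t : ℝ) {v : NNReal} (hv : v ≠ 0) :
    0 < ∫ s in Iic t, gaussianPDFReal μ v s := by
  rw [setIntegral_pos_iff_support_of_nonneg_ae
    (Eventually.of_forall fun s => gaussianPDFReal_nonneg μ v s)
    (integrable_gaussianPDFReal μ v).integrableOn]
  have : Function.support (gaussianPDFReal μ v) = univ :=
    eq_univ_of_forall fun s => (gaussianPDFReal_pos μ v s hv).ne'
  simp [this]

/-- The projected posterior mean `θ·Φ(θ/σ) + σ·φ(θ/σ)` (the mean of `N(θ, σ²)` pushed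
forward under `x ↦ max(x, 0)`) lies between `θ` and the mean `θ + σ·φ(θ/σ)/Φ(θ/σ)` of the
normal distribution truncated to `[0, ∞)`; here `φ` and `Φ` are the standard normal density
and cumulative distribution function. -/
theorem projected_mean_between (θ σ : ℝ) (hσ : 0 < σ) :
    let φ : ℝ → ℝ := fun t => (Real.sqrt (2 * Real.pi))⁻¹ * Real.exp (-t ^ 2 / 2)
    let Φ : ℝ → ℝ := fun t => ∫ s in Set.Iic t, φ s
    θ ≤ θ * Φ (θ / σ) + σ * φ (θ / σ) ∧
    θ * Φ (θ / σ) + σ * φ (θ / σ) ≤ θ + σ * φ (θ / σ) / Φ (θ / σ) := by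
  intro φ Φ
  have hφ : φ = gaussianPDFReal 0 1 :=
    funext fun s => (gaussianPDFReal_zero_one_apply s).symm
  obtain ⟨t, rfl⟩ : ∃ t, θ = σ * t := ⟨θ / σ, by field_simp⟩
  rw [mul_div_cancel_left₀ t hσ.ne']
  have hpos : 0 < Φ t := by
    simp only [Φ, hφ]
    exact integral_Iic_gaussianPDFReal_pos 0 t one_ne_zero
  have hsum : Φ t + ∫ s in Ioi t, φ s = 1 := by
    simp only [Φ, hφ]
    rw [← integral_gaussianPDFReal_eq_one 0 (one_ne_zero (α := NNReal)), ← compl_Iic]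
    exact integral_add_compl measurableSet_Iic (integrable_gaussianPDFReal 0 1)
  have htail : 0 ≤ ∫ s in Ioi t, φ s := by
    rw [hφ]
    exact integral_nonneg fun s => gaussianPDFReal_nonneg 0 1 s
  have hupper : t * (∫ s in Ioi t, φ s) ≤ φ t := by
    rw [hφ]
    exact mul_integral_Ioi_gaussianPDFReal_le t
  have hlower : 0 ≤ t * Φ t + φ t := by
    have := mul_integral_Ioi_gaussianPDFReal_le (-t)
    rw [← integral_Iic_gaussianPDFReal_zero, gaussianPDFReal_zero_neg, ← hφ] at this
    change -t * Φ t ≤ φ t at this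
    linarith
  rw [← eq_sub_iff_add_eq'] at hsum
  rw [hsum] at hupper htail
  constructor
  · nlinarith
  · rw [← sub_nonneg]
    have : σ * t + σ * φ t / Φ t - (σ * t * Φ t + σ * φ t) =
        σ * ((1 - Φ t) * (t * Φ t + φ t)) / Φ t := by
      field_simp
    rw [this]
    positivity
end
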